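/- arXiv:math/0110314 — 2 statements merged into one kernel-verified Lean document; each statement's English description precedes it below -/
import Mathlib

section
/- (Recoverability of the word from its pair of split words.) Fix natural numbers n ≤ m. The map sending an index tuple (i_0,…,i_n) to the pair of Boolean words (w⁺(i), w⁻(i)) is injective: if two strictly increasing tuples 0 ≤ i_0 < ⋯ < i_n ≤ m and 0 ≤ i'_0 < ⋯ < i'_n ≤ m satisfy w⁺(i) = w⁺(i') and w⁻(i) = w⁻(i'), then i_k = i'_k for all 0 ≤ k ≤ n. -/
/-- The value `i_t` of an index tuple `0 ≤ i_0 < i_1 < ⋯ < i_n ≤ m`, regarded as a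
strictly monotone function `Fin (n+1) → Fin (m+1)`, extended by `0` outside range. -/
def ival (n m : ℕ) (i : Fin (n + 1) → Fin (m + 1)) (t : ℕ) : ℕ :=
  if h : t ≤ n then (i ⟨t, Nat.lt_succ_of_le h⟩ : ℕ) else 0

/-- Block lengths of the word `(i_0,…,i_n)_m`: `b_0 = i_0`,
`b_j = i_j − i_{j−1} − 1` for `1 ≤ j ≤ n`, and `b_{n+1} = m − i_n`. -/
def blockLen (n m : ℕ) (i : Fin (n + 1) → Fin (m + 1)) (j : ℕ) : ℕ :=
  if j = 0 then ival n m i 0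
  else if j ≤ n then ival n m i j - ival n m i (j - 1) - 1
  else m - ival n m i n

/-- The number of letters `1` in the word `(i_0,…,i_n)_m^+`: the sum of the
block lengths `b_j` over odd `j` with `0 ≤ j ≤ n+1`. -/
def onesPlus (n m : ℕ) (i : Fin (n + 1) → Fin (m + 1)) : ℕ :=
  ∑ j ∈ Finset.range (n + 2), if Odd j then blockLen n m i j else 0

/-- The number of letters `1` in the word `(i_0,…,i_n)_m^-`: the sum of the
block lengths `b_j` over even `j` with `0 ≤ j ≤ n+1`. -/
def onesMinus (n m : ℕ) (i : Fin (n + 1) → Fin (m + 1)) : ℕ :=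
  ∑ j ∈ Finset.range (n + 2), if Even j then blockLen n m i j else 0

/-- The `j`-th block of the word `(i_0,…,i_n)_m`, as a Boolean word (letter `1`
is `true`, letter `0` is `false`): for `0 ≤ j ≤ n` it consists of `b_j` letters
`1` followed by a single letter `0`; the `(n+1)`-block consists of `b_{n+1}`
letters `1`. -/
def blockWord (n m : ℕ) (i : Fin (n + 1) → Fin (m + 1)) (j : ℕ) : List Bool :=
  if j ≤ n then List.replicate (blockLen n m i j) true ++ [false]
  else List.replicate (blockLen n m i j) true

/-- The plus word `(i_0,…,i_n)_m^+`: the concatenation, in increasing order of `j`,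
of the blocks `B_j` with `j` odd, `0 ≤ j ≤ n+1` (so including the final block
`B_{n+1}` exactly when `n` is even). -/
def wPlus (n m : ℕ) (i : Fin (n + 1) → Fin (m + 1)) : List Bool :=
  ((List.range (n + 2)).filter fun j => j % 2 = 1).flatMap (blockWord n m i)

/-- The minus word `(i_0,…,i_n)_m^-`: the concatenation, in increasing order of `j`,
of the blocks `B_j` with `j` even, `0 ≤ j ≤ n+1` (so including the final block
`B_{n+1}` exactly when `n` is odd). -/
def wMinus (n m : ℕ) (i : Fin (n + 1) → Fin (m + 1)) : List Bool :=
  ((List.range (n + 2)).filter fun j => j % 2 = 0).flatMap (blockWord n m i)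

theorem replicate_true_append_false_cons_inj {a b : ℕ} {X Y : List Bool}
    (h : List.replicate a true ++ false :: X = List.replicate b true ++ false :: Y) :
    a = b ∧ X = Y := by
  induction a generalizing b with
  | zero => cases b <;> simp_all [List.replicate_succ]
  | succ a ih =>
    cases b with
    | zero => simp [List.replicate_succ] at h
    | succ b =>
      simp only [List.replicate_succ, List.cons_append, List.cons.injEq, true_and] at h
      obtain ⟨hab, hXY⟩ := ih h
      exact ⟨by rw [hab], hXY⟩

/-- A concatenation of blocks taken in increasing order of index determines the lengths of
all the blocks that end in the letter `0`. -/
theorem blockLen_eq_of_flatMap_blockWord_eq {n m : ℕ} {i i' : Fin (n + 1) → Fin (m + 1)}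
    {L : List ℕ} (hL : L.Pairwise (· < ·))
    (h : L.flatMap (blockWord n m i) = L.flatMap (blockWord n m i')) :
    ∀ j ∈ L, j ≤ n → blockLen n m i j = blockLen n m i' j := by
  induction L with
  | nil => simp
  | cons a L ih =>
    obtain ⟨ha, hL⟩ := List.pairwise_cons.1 hL
    by_cases han : a ≤ n
    · simp only [List.flatMap_cons, blockWord, han, if_true, List.append_assoc,
        List.singleton_append] at h
      obtain ⟨hlen, hrest⟩ := replicate_true_append_false_cons_inj h
      intro j hj hjn
      rcases List.mem_cons.1 hj with rfl | hj
      · exact hlen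
      · exact ih hL hrest j hj hjn
    · intro j hj hjn
      rcases List.mem_cons.1 hj with rfl | hj
      · exact absurd hjn han
      · have := ha j hj
        omega

theorem blockLen_eq_of_words_eq {n m : ℕ} {i i' : Fin (n + 1) → Fin (m + 1)}
    (hplus : wPlus n m i = wPlus n m i') (hminus : wMinus n m i = wMinus n m i')
    {j : ℕ} (hj : j ≤ n) : blockLen n m i j = blockLen n m i' j := by
  rcases Nat.mod_two_eq_zero_or_one j with h | h
  · exact blockLen_eq_of_flatMap_blockWord_eq (List.pairwise_lt_range.filter _) hminus j
      (by simp [h]; omega) hj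
  · exact blockLen_eq_of_flatMap_blockWord_eq (List.pairwise_lt_range.filter _) hplus j
      (by simp [h]; omega) hj

theorem ival_lt_ival_succ {n m : ℕ} {i : Fin (n + 1) → Fin (m + 1)} (hi : StrictMono i)
    {t : ℕ} (ht : t + 1 ≤ n) : ival n m i t < ival n m i (t + 1) := by
  have ht' : t ≤ n := by omega
  simp only [ival, ht, ht', dif_pos]
  exact hi (Fin.mk_lt_mk.2 t.lt_succ_self)

/-- The block lengths `b_0, …, b_n` determine the index tuple. -/
theorem ival_eq_of_blockLen_eq {n m : ℕ} {i i' : Fin (n + 1) → Fin (m + 1)}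
    (hi : StrictMono i) (hi' : StrictMono i')
    (h : ∀ j ≤ n, blockLen n m i j = blockLen n m i' j) {t : ℕ} (ht : t ≤ n) :
    ival n m i t = ival n m i' t := by
  induction t with
  | zero => simpa [blockLen] using h 0 ht
  | succ t ih =>
    have hb := h (t + 1) ht
    simp only [blockLen, Nat.succ_ne_zero, if_false, ht, if_true, Nat.add_sub_cancel] at hb
    have := ih (by omega)
    have := ival_lt_ival_succ hi ht
    have := ival_lt_ival_succ hi' ht
    omega

/-- The word `(i_0,…,i_n)_m` can be recovered from its pair of split words: the map
sending a strictly increasing tuple `0 ≤ i_0 < ⋯ < i_n ≤ m` to the pair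
`(w⁺(i), w⁻(i))` is injective. -/
theorem word_pair_injective (n m : ℕ) (hnm : n ≤ m)
    (i i' : Fin (n + 1) → Fin (m + 1)) (hi : StrictMono i) (hi' : StrictMono i')
    (hplus : wPlus n m i = wPlus n m i') (hminus : wMinus n m i = wMinus n m i') :
    i = i' := by
  have hb : ∀ j ≤ n, blockLen n m i j = blockLen n m i' j :=
    fun _ hj => blockLen_eq_of_words_eq hplus hminus hj
  ext k
  have hk : (k : ℕ) ≤ n := Nat.lt_succ_iff.1 k.2
  simpa [ival, hk] using ival_eq_of_blockLen_eq hi hi' hb hk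
end

section
/- Let n be an odd natural number and p, q natural numbers with n ≤ p, n ≤ q; set m = p + q − n. The map i ↦ (w⁺(i), w⁻(i)) is a bijection from the set of strictly increasing tuples 0 ≤ i_0 < ⋯ < i_n ≤ m with onesPlus(i) = q − n onto the set of pairs (u, v) of Boolean words such that u contains exactly (n+1)/2 letters 0 and exactly q − n letters 1 and its last letter is 0, and v contains exactly (n+1)/2 letters 0 and exactly p − n letters 1. -/
/-- The word consisting, for `j = 0, …, k - 1`, of `b j` letters `1` followed by a letter `0`. -/
def runsWord (b : ℕ → ℕ) (k : ℕ) : List Bool :=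
  (List.range k).flatMap fun j => List.replicate (b j) true ++ [false]

theorem runsWord_zero (b : ℕ → ℕ) : runsWord b 0 = [] := rfl

theorem runsWord_succ (b : ℕ → ℕ) (k : ℕ) :
    runsWord b (k + 1) = runsWord b k ++ (List.replicate (b k) true ++ [false]) := by
  simp [runsWord, List.range_succ]

theorem runsWord_succ' (b : ℕ → ℕ) (k : ℕ) :
    runsWord b (k + 1) =
      List.replicate (b 0) true ++ false :: runsWord (fun j => b (j + 1)) k := by
  simp [runsWord, List.range_succ_eq_map, List.flatMap_map]

theorem runsWord_congr {b b' : ℕ → ℕ} {k : ℕ} (h : ∀ j < k, b j = b' j) :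
    runsWord b k = runsWord b' k := by
  induction k with
  | zero => rfl
  | succ k ih =>
    rw [runsWord_succ, runsWord_succ, ih fun j hj => h j (by omega), h k (by omega)]

theorem count_false_runsWord (b : ℕ → ℕ) (k : ℕ) : (runsWord b k).count false = k := by
  induction k with
  | zero => rfl
  | succ k ih => simp [runsWord_succ, ih, List.count_replicate]

theorem count_true_runsWord (b : ℕ → ℕ) (k : ℕ) :
    (runsWord b k).count true = ∑ j ∈ Finset.range k, b j := by
  induction k with
  | zero => rfl
  | succ k ih => simp [runsWord_succ, ih, Finset.sum_range_succ]

theorem replicate_true_append_false_inj {a a' : ℕ} {x x' : List Bool}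
    (h : List.replicate a true ++ false :: x = List.replicate a' true ++ false :: x') :
    a = a' ∧ x = x' := by
  induction a generalizing a' with
  | zero => cases a' <;> simp_all [List.replicate_succ]
  | succ a ih =>
    cases a' with
    | zero => simp [List.replicate_succ] at h
    | succ a' =>
      simp only [List.replicate_succ, List.cons_append, List.cons.injEq, true_and] at h
      simpa using ih h

theorem runsWord_append_replicate_inj {b b' : ℕ → ℕ} {k c c' : ℕ}
    (h : runsWord b k ++ List.replicate c true = runsWord b' k ++ List.replicate c' true) :
    (∀ j < k, b j = b' j) ∧ c = c' := by
  induction k generalizing b b' with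
  | zero => simpa [runsWord_zero] using congrArg List.length h
  | succ k ih =>
    simp only [runsWord_succ', List.append_assoc, List.cons_append] at h
    obtain ⟨h0, h1⟩ := replicate_true_append_false_inj h
    obtain ⟨h2, h3⟩ := ih h1
    refine ⟨fun j hj => ?_, h3⟩
    cases j with
    | zero => exact h0
    | succ j => exact h2 j (by omega)

theorem exists_eq_runsWord_append_replicate (w : List Bool) :
    ∃ b : ℕ → ℕ, ∃ c, w = runsWord b (w.count false) ++ List.replicate c true := by
  induction w using List.reverseRecOn with
  | nil => exact ⟨0, 0, rfl⟩
  | append_singleton w x ih =>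
    obtain ⟨b, c, h⟩ := ih
    cases x with
    | true =>
      refine ⟨b, c + 1, ?_⟩
      have hc : (w ++ [true]).count false = w.count false := by simp
      rw [hc, List.replicate_succ', ← List.append_assoc, ← h]
    | false =>
      refine ⟨Function.update b (w.count false) c, 0, ?_⟩
      have hc : (w ++ [false]).count false = w.count false + 1 := by simp
      have hb : runsWord (Function.update b (w.count false) c) (w.count false) =
          runsWord b (w.count false) :=
        runsWord_congr fun j hj => Function.update_of_ne hj.ne _ _
      rw [hc, runsWord_succ, hb, Function.update_self, ← List.append_assoc, ← h]
      simp

theorem filter_odd_range (k : ℕ) :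
    ((List.range (2 * k + 1)).filter fun j => j % 2 = 1) =
      (List.range k).map fun t => 2 * t + 1 := by
  induction k with
  | zero => rfl
  | succ k ih =>
    rw [show 2 * (k + 1) + 1 = 2 * k + 1 + 1 + 1 by ring, List.range_succ,
      List.range_succ, List.filter_append, List.filter_append, ih, List.range_succ]
    simp [Nat.add_mod]

theorem filter_even_range (k : ℕ) :
    ((List.range (2 * k + 1)).filter fun j => j % 2 = 0) =
      (List.range (k + 1)).map fun t => 2 * t := by
  induction k with
  | zero => rfl
  | succ k ih =>
    rw [show 2 * (k + 1) + 1 = 2 * k + 1 + 1 + 1 by ring, List.range_succ,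
      List.range_succ, List.filter_append, List.filter_append, ih, List.range_succ (n := k + 1)]
    simp [Nat.add_mod, mul_add]

theorem sum_range_odd (f : ℕ → ℕ) (k : ℕ) :
    (∑ j ∈ Finset.range (2 * k + 1), if Odd j then f j else 0) =
      ∑ t ∈ Finset.range k, f (2 * t + 1) := by
  induction k with
  | zero => simp
  | succ k ih =>
    rw [show 2 * (k + 1) + 1 = 2 * k + 1 + 1 + 1 by ring, Finset.sum_range_succ,
      Finset.sum_range_succ, ih, Finset.sum_range_succ]
    simp [Nat.odd_add_one]

theorem sum_range_even_add_odd (f : ℕ → ℕ) (k : ℕ) :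
    ∑ j ∈ Finset.range (2 * k + 1), f j =
      ∑ t ∈ Finset.range (k + 1), f (2 * t) + ∑ t ∈ Finset.range k, f (2 * t + 1) := by
  induction k with
  | zero => simp
  | succ k ih =>
    rw [show 2 * (k + 1) + 1 = 2 * k + 1 + 1 + 1 by ring, Finset.sum_range_succ,
      Finset.sum_range_succ, ih, Finset.sum_range_succ _ (k + 1), Finset.sum_range_succ _ k]
    simp only [Finset.sum_range_succ, mul_add, mul_one]
    ring_nf

section OddBlocks

variable (k m : ℕ) (i : Fin (2 * k + 1 + 1) → Fin (m + 1))

theorem wPlus_eq_runsWord :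
    wPlus (2 * k + 1) m i = runsWord (fun t => blockLen (2 * k + 1) m i (2 * t + 1)) (k + 1) := by
  rw [wPlus, show 2 * k + 1 + 2 = 2 * (k + 1) + 1 by ring, filter_odd_range, List.flatMap_map]
  refine List.flatMap_congr fun t ht => ?_
  rw [List.mem_range] at ht
  rw [blockWord, if_pos (by omega)]

theorem wMinus_eq_runsWord_append :
    wMinus (2 * k + 1) m i = runsWord (fun t => blockLen (2 * k + 1) m i (2 * t)) (k + 1) ++
      List.replicate (blockLen (2 * k + 1) m i (2 * (k + 1))) true := by
  rw [wMinus, show 2 * k + 1 + 2 = 2 * (k + 1) + 1 by ring, filter_even_range, List.flatMap_map,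
    List.range_succ, List.flatMap_append]
  congr 1
  · refine List.flatMap_congr fun t ht => ?_
    rw [List.mem_range] at ht
    rw [blockWord, if_pos (by omega)]
  · rw [List.flatMap_singleton, blockWord, if_neg (by omega)]

theorem onesPlus_eq_sum :
    onesPlus (2 * k + 1) m i =
      ∑ t ∈ Finset.range (k + 1), blockLen (2 * k + 1) m i (2 * t + 1) := by
  rw [onesPlus, show 2 * k + 1 + 2 = 2 * (k + 1) + 1 by ring, sum_range_odd]

end OddBlocks

section Tuples

variable {n m : ℕ} {i : Fin (n + 1) → Fin (m + 1)}

theorem ival_of_le {t : ℕ} (h : t ≤ n) : ival n m i t = i ⟨t, Nat.lt_succ_of_le h⟩ :=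
  dif_pos h

theorem ival_eq_add_sum_blockLen (hi : StrictMono i) {t : ℕ} (ht : t ≤ n) :
    ival n m i t = t + ∑ j ∈ Finset.range (t + 1), blockLen n m i j := by
  induction t with
  | zero => simp [blockLen]
  | succ t ih =>
    have hlt : ival n m i t < ival n m i (t + 1) := by
      rw [ival_of_le ht, ival_of_le (by omega)]
      exact hi (Fin.mk_lt_mk.2 t.lt_succ_self)
    rw [Finset.sum_range_succ, blockLen, if_neg (by omega), if_pos ht, Nat.add_sub_cancel]
    have := ih (by omega)
    omega

theorem add_sum_blockLen (hi : StrictMono i) :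
    n + ∑ j ∈ Finset.range (n + 2), blockLen n m i j = m := by
  have h := ival_eq_add_sum_blockLen hi le_rfl
  have hle : ival n m i n ≤ m := by
    rw [ival_of_le le_rfl]
    exact Nat.lt_succ_iff.1 (Fin.is_lt _)
  rw [Finset.sum_range_succ, blockLen, if_neg (by omega), if_neg (by omega)]
  omega

theorem eq_of_blockLen_eq {i' : Fin (n + 1) → Fin (m + 1)} (hi : StrictMono i)
    (hi' : StrictMono i') (h : ∀ j ≤ n, blockLen n m i j = blockLen n m i' j) : i = i' := by
  funext ⟨t, ht⟩
  have ht : t ≤ n := by omega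
  have hval : ival n m i t = ival n m i' t := by
    rw [ival_eq_add_sum_blockLen hi ht, ival_eq_add_sum_blockLen hi' ht]
    congr 1
    exact Finset.sum_congr rfl fun j hj => h j (by rw [Finset.mem_range] at hj; omega)
  rw [ival_of_le ht, ival_of_le ht] at hval
  exact Fin.ext hval

theorem exists_strictMono_blockLen_eq {b : ℕ → ℕ}
    (hb : n + ∑ j ∈ Finset.range (n + 2), b j = m) :
    ∃ i : Fin (n + 1) → Fin (m + 1), StrictMono i ∧ ∀ j ≤ n + 1, blockLen n m i j = b j := by
  set s : ℕ → ℕ := fun t => t + ∑ j ∈ Finset.range (t + 1), b j with hs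
  have hsucc (t : ℕ) : s (t + 1) = s t + 1 + b (t + 1) := by
    simp only [hs, Finset.sum_range_succ _ (t + 1)]
    ring
  have hmono : StrictMono s := strictMono_nat_of_lt_succ fun t => by
    rw [hsucc]
    omega
  have hn : s n + b (n + 1) = m := by
    rw [Finset.sum_range_succ] at hb
    simp only [hs]
    omega
  have hlt (t : Fin (n + 1)) : s t < m + 1 := by
    have := hmono.monotone (show (t : ℕ) ≤ n by omega)
    omega
  refine ⟨fun t => ⟨s t, hlt t⟩, fun t t' h => Fin.mk_lt_mk.2 (hmono h), fun j hj => ?_⟩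
  have hval (t : ℕ) (ht : t ≤ n) : ival n m (fun t => ⟨s t, hlt t⟩) t = s t := ival_of_le ht
  rw [blockLen]
  split_ifs with h0 h1
  · rw [hval 0 (by omega), h0]
    simp [hs]
  · obtain ⟨j, rfl⟩ := Nat.exists_eq_succ_of_ne_zero h0
    have := hsucc j
    rw [hval _ h1, hval _ (by omega), Nat.succ_eq_add_one, Nat.add_sub_cancel]
    omega
  · rw [hval n le_rfl, show j = n + 1 by omega]
    omega

end Tuples

/-- For `n` odd, `n ≤ p`, `n ≤ q`, `m = p + q − n`, the map `i ↦ (w⁺(i), w⁻(i))`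
is a bijection from the set of strictly increasing tuples `0 ≤ i_0 < ⋯ < i_n ≤ m`
with `onesPlus(i) = q − n` onto the set of pairs `(u, v)` of Boolean words such
that `u` has exactly `(n+1)/2` letters `0`, `q − n` letters `1`, and its last
letter is `0`, and `v` has exactly `(n+1)/2` letters `0` and `p − n` letters `1`. -/
theorem word_pair_bijOn_odd (n p q m : ℕ) (hn : Odd n) (hnp : n ≤ p)
    (hnq : n ≤ q) (hm : m = p + q - n) :
    Set.BijOn (fun i : Fin (n + 1) → Fin (m + 1) => (wPlus n m i, wMinus n m i))
      {i | StrictMono i ∧ onesPlus n m i = q - n}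
      {uv : List Bool × List Bool |
        uv.1.count false = (n + 1) / 2 ∧ uv.1.count true = q - n ∧
        uv.1.getLast? = some false ∧
        uv.2.count false = (n + 1) / 2 ∧ uv.2.count true = p - n} := by
  obtain ⟨k, rfl⟩ := hn
  have hk : (2 * k + 1 + 1) / 2 = k + 1 := by omega
  have hlast (i : Fin (2 * k + 1 + 1) → Fin (m + 1)) (hi : StrictMono i) :
      2 * k + 1 + (∑ t ∈ Finset.range (k + 2), blockLen (2 * k + 1) m i (2 * t) +
        ∑ t ∈ Finset.range (k + 1), blockLen (2 * k + 1) m i (2 * t + 1)) = m := by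
    rw [← sum_range_even_add_odd, show 2 * (k + 1) + 1 = 2 * k + 1 + 2 by ring]
    exact add_sum_blockLen hi
  refine ⟨?_, ?_, ?_⟩
  · rintro i ⟨hi, hones⟩
    have htotal := hlast i hi
    rw [onesPlus_eq_sum] at hones
    rw [Finset.sum_range_succ, hones] at htotal
    simp only [Set.mem_ofPred_eq, wPlus_eq_runsWord, wMinus_eq_runsWord_append, hk,
      List.count_append, count_false_runsWord, count_true_runsWord, List.count_replicate_self]
    refine ⟨trivial, hones, ?_, by simp [List.count_replicate], by omega⟩
    simp [runsWord_succ, List.getLast?_append]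
  · rintro i ⟨hi, -⟩ i' ⟨hi', -⟩ h
    simp only [wPlus_eq_runsWord, wMinus_eq_runsWord_append, Prod.mk.injEq] at h
    obtain ⟨hodd, -⟩ := runsWord_append_replicate_inj
      (congrArg (· ++ List.replicate 0 true) h.1)
    obtain ⟨heven, -⟩ := runsWord_append_replicate_inj h.2
    refine eq_of_blockLen_eq hi hi' fun j hj => ?_
    obtain ⟨t, rfl | rfl⟩ := j.even_or_odd'
    · exact heven t (by omega)
    · exact hodd t (by omega)
  · rintro ⟨u, v⟩ ⟨hu0, hu1, hul, hv0, hv1⟩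
    simp only [hk] at hu0 hu1 hul hv0 hv1
    obtain ⟨b, c, hu⟩ := exists_eq_runsWord_append_replicate u
    obtain ⟨b', c', hv⟩ := exists_eq_runsWord_append_replicate v
    rw [hu0] at hu
    rw [hv0] at hv
    obtain rfl : c = 0 := by
      cases c with
      | zero => rfl
      | succ c => simp [hu, List.replicate_succ', ← List.append_assoc] at hul
    rw [List.replicate_zero, List.append_nil] at hu
    set f : ℕ → ℕ := fun j =>
      if j % 2 = 1 then b (j / 2) else if j / 2 < k + 1 then b' (j / 2) else c' with hf
    have hfodd (t : ℕ) : f (2 * t + 1) = b t := by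
      rw [hf]
      simp only [show (2 * t + 1) % 2 = 1 by omega, show (2 * t + 1) / 2 = t by omega, if_true]
    have hfeven {t : ℕ} (ht : t < k + 1) : f (2 * t) = b' t := by
      simp only [hf, show 2 * t % 2 ≠ 1 by omega, show 2 * t / 2 = t by omega, if_false, if_pos ht]
    have hflast : f (2 * (k + 1)) = c' := by
      simp [hf]
    have hsum : 2 * k + 1 + ∑ j ∈ Finset.range (2 * k + 1 + 2), f j = m := by
      rw [show 2 * k + 1 + 2 = 2 * (k + 1) + 1 by ring, sum_range_even_add_odd,
        Finset.sum_range_succ, hflast,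
        Finset.sum_congr rfl fun t ht => hfeven (Finset.mem_range.1 ht)]
      simp only [hfodd]
      rw [hu, count_true_runsWord] at hu1
      rw [hv, List.count_append, count_true_runsWord, List.count_replicate_self] at hv1
      omega
    obtain ⟨i, hi, hblock⟩ := exists_strictMono_blockLen_eq hsum
    have hplus : wPlus (2 * k + 1) m i = u := by
      rw [wPlus_eq_runsWord, hu]
      exact runsWord_congr fun t ht => by rw [hblock _ (by omega), hfodd]
    have hminus : wMinus (2 * k + 1) m i = v := by
      rw [wMinus_eq_runsWord_append, hv, hblock _ (by omega), hflast]
      congr 1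
      exact runsWord_congr fun t ht => by rw [hblock _ (by omega), hfeven ht]
    refine ⟨i, ⟨hi, ?_⟩, Prod.ext hplus hminus⟩
    rw [onesPlus_eq_sum, ← count_true_runsWord, ← wPlus_eq_runsWord, hplus, hu1]
end
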